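/- Let n ≥ 3, let R be a commutative ring and I an ideal of R. Then the relative elementary subgroup E(n,R,I) is generated, as a group, by the elements z_ij(ξ,ζ) = t_ji(ζ)·t_ij(ξ)·t_ji(−ζ), where 1 ≤ i ≠ j ≤ n, ξ ∈ I and ζ ∈ R. -/

import Mathlib

open Matrix

/-- The elementary transvection `e + ξ e_{ij}` as an element of `SL(n,R)`. -/
def elemT {n : ℕ} {R : Type*} [CommRing R] (i j : Fin n) (hij : i ≠ j) (ξ : R) :
    Matrix.SpecialLinearGroup (Fin n) R :=
  ⟨Matrix.transvection i j ξ, Matrix.det_transvection_of_ne i j hij ξ⟩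

/-- The set of elementary transvections in `SL(n,R)`. -/
def elemSet (n : ℕ) (R : Type*) [CommRing R] :
    Set (Matrix.SpecialLinearGroup (Fin n) R) :=
  { g | ∃ i j : Fin n, ∃ hij : i ≠ j, ∃ ξ : R, g = elemT i j hij ξ }

/-- The elementary subgroup `E(n,R)` of `SL(n,R)`. -/
def elemSubgroup (n : ℕ) (R : Type*) [CommRing R] :
    Subgroup (Matrix.SpecialLinearGroup (Fin n) R) :=
  Subgroup.closure (elemSet n R)

/-- The set of elementary transvections of level `I`. -/
def elemSetIdeal (n : ℕ) {R : Type*} [CommRing R] (I : Ideal R) :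
    Set (Matrix.SpecialLinearGroup (Fin n) R) :=
  { g | ∃ i j : Fin n, ∃ hij : i ≠ j, ∃ ξ : R, ξ ∈ I ∧ g = elemT i j hij ξ }

/-- The subgroup `E(n,I)` generated by the elementary transvections of level `I`. -/
def elemSubgroupIdeal (n : ℕ) {R : Type*} [CommRing R] (I : Ideal R) :
    Subgroup (Matrix.SpecialLinearGroup (Fin n) R) :=
  Subgroup.closure (elemSetIdeal n I)

/-- The relative elementary subgroup `E(n,R,I)`: the normal closure of `E(n,I)`
in `E(n,R)`. -/
def relElemSubgroup (n : ℕ) {R : Type*} [CommRing R] (I : Ideal R) :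
    Subgroup (Matrix.SpecialLinearGroup (Fin n) R) :=
  Subgroup.closure
    { g | ∃ h ∈ elemSubgroup n R, ∃ x ∈ elemSubgroupIdeal n I, g = h * x * h⁻¹ }

/-- The principal congruence subgroup `SL(n,R,I)`: the kernel of reduction modulo `I`. -/
def congrSubgroup (n : ℕ) {R : Type*} [CommRing R] (I : Ideal R) :
    Subgroup (Matrix.SpecialLinearGroup (Fin n) R) :=
  (Matrix.SpecialLinearGroup.map (Ideal.Quotient.mk I)).ker

/-- The elementary generator `z_{ij}(ξ,ζ) = t_{ji}(ζ) t_{ij}(ξ) t_{ji}(−ζ)` of the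
relative elementary subgroup. -/
def zElem {n : ℕ} {R : Type*} [CommRing R] (i j : Fin n) (hij : i ≠ j) (ξ ζ : R) :
    Matrix.SpecialLinearGroup (Fin n) R :=
  elemT j i hij.symm ζ * elemT i j hij ξ * elemT j i hij.symm (-ζ)

/-- The set of elementary generators `z_{ij}(ξ,ζ)`, `ξ ∈ I`, `ζ ∈ R`, of `E(n,R,I)`. -/
def zSet (n : ℕ) {R : Type*} [CommRing R] (I : Ideal R) :
    Set (Matrix.SpecialLinearGroup (Fin n) R) :=
  { g | ∃ i j : Fin n, ∃ hij : i ≠ j, ∃ ξ ∈ I, ∃ ζ : R, g = zElem i j hij ξ ζ }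

namespace elemT

variable {n : ℕ} {R : Type*} [CommRing R] {i j k l : Fin n}

theorem coe_eq (hij : i ≠ j) (ξ : R) :
    (elemT i j hij ξ : Matrix (Fin n) (Fin n) R) = 1 + single i j ξ := rfl

theorem mul_eq_add (hij : i ≠ j) (ξ η : R) :
    elemT i j hij ξ * elemT i j hij η = elemT i j hij (ξ + η) :=
  Subtype.ext (transvection_mul_transvection_same _ _ hij ξ η)

theorem mul_neg_self (hij : i ≠ j) (ξ : R) : elemT i j hij ξ * elemT i j hij (-ξ) = 1 := by
  rw [mul_eq_add, add_neg_cancel]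
  exact Subtype.ext (transvection_zero i j)

theorem inv_eq (hij : i ≠ j) (ξ : R) : (elemT i j hij ξ)⁻¹ = elemT i j hij (-ξ) :=
  inv_eq_of_mul_eq_one_right (mul_neg_self hij ξ)

theorem commute (hij : i ≠ j) (hkl : k ≠ l) (hjk : j ≠ k) (hli : l ≠ i) (ξ η : R) :
    Commute (elemT i j hij ξ) (elemT k l hkl η) := by
  apply Subtype.ext
  simp [coe_eq, mul_add, add_mul, hjk, hli]
  abel

end elemT

namespace zElem

variable {n : ℕ} {R : Type*} [CommRing R] {i j h : Fin n}

theorem zero_right (hij : i ≠ j) (ξ : R) : zElem i j hij ξ 0 = elemT i j hij ξ := by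
  apply Subtype.ext
  simp [zElem, elemT.coe_eq]

theorem coe_eq (hij : i ≠ j) (ξ ζ : R) :
    (zElem i j hij ξ ζ : Matrix (Fin n) (Fin n) R) =
      1 + single i j ξ + single j j (ζ * ξ) - single i i (ξ * ζ) - single j i (ζ * ξ * ζ) := by
  simp [zElem, elemT.coe_eq, mul_add, add_mul, hij]
  have (a b : Fin n) (x : R) : single a b (-x) = -single a b x := by ext; simp [single]; grind
  simp only [this]
  abel

variable (hij : i ≠ j) (hhi : h ≠ i) (hhj : h ≠ j) (ξ ζ η : R)

theorem conj_third_fst :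
    elemT h i hhi η * zElem i j hij ξ ζ * elemT h i hhi (-η) =
      elemT h j hhj (ξ * η) * elemT h i hhi (-(ξ * η * ζ)) * zElem i j hij ξ ζ := by
  apply Subtype.ext
  simp [elemT.coe_eq, coe_eq, mul_add, add_mul, mul_sub, sub_mul, hij, hij.symm,
    hhi.symm, hhj.symm]
  ext a b
  simp [single]
  grind

theorem conj_third_snd :
    elemT h j hhj η * zElem i j hij ξ ζ * elemT h j hhj (-η) =
      elemT h j hhj (ξ * η * ζ) * elemT h i hhi (-(ξ * η * ζ * ζ)) * zElem i j hij ξ ζ := by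
  apply Subtype.ext
  simp [elemT.coe_eq, coe_eq, mul_add, add_mul, mul_sub, sub_mul, hij, hij.symm,
    hhi.symm, hhj.symm]
  ext a b
  simp [single]
  grind

theorem conj_fst_third :
    elemT i h hhi.symm η * zElem i j hij ξ ζ * elemT i h hhi.symm (-η) =
      elemT i h hhi.symm (ξ * η * ζ) * elemT j h hhj.symm (ξ * η * ζ * ζ) *
        zElem i j hij ξ ζ := by
  apply Subtype.ext
  simp [elemT.coe_eq, coe_eq, mul_add, add_mul, mul_sub, sub_mul, hij.symm, hhi, hhj]
  ext a b
  simp [single]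
  grind

theorem conj_snd_third :
    elemT j h hhj.symm η * zElem i j hij ξ ζ * elemT j h hhj.symm (-η) =
      elemT i h hhi.symm (-(ξ * η)) * elemT j h hhj.symm (-(ξ * η * ζ)) *
        zElem i j hij ξ ζ := by
  apply Subtype.ext
  simp [elemT.coe_eq, coe_eq, mul_add, add_mul, mul_sub, sub_mul, hij, hhi, hhj]
  ext a b
  simp [single]
  grind

theorem conj_fst_snd :
    elemT i j hij η * zElem i j hij ξ ζ * elemT i j hij (-η) =
      elemT i h hhi.symm (ξ * (1 + η * ζ)) * elemT j h hhj.symm (ξ * ζ) *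
        (elemT h j hhj (1 + η * ζ) * zElem i h hhi.symm (-(ξ * (1 + η * ζ))) (-ζ) *
          elemT h j hhj (-(1 + η * ζ))) *
        (elemT h i hhi (-ζ) * zElem j h hhj.symm (-(ξ * ζ)) (1 + η * ζ) *
          elemT h i hhi (- -ζ)) := by
  rw [conj_snd_third hhi.symm hij.symm hhj.symm, conj_snd_third hhj.symm hij hhi.symm]
  apply Subtype.ext
  generalize hc : 1 + η * ζ = c
  simp [elemT.coe_eq, coe_eq, mul_add, add_mul, mul_sub, sub_mul, hij, hij.symm, hhi, hhj,
    hhi.symm, hhj.symm]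
  ext a b
  simp [single]
  grind

end zElem

section Closure

variable {n : ℕ} {R : Type*} [CommRing R] {I : Ideal R}

theorem zElem_mem_closure_zSet {i j : Fin n} (hij : i ≠ j) {ξ : R} (hξ : ξ ∈ I) (ζ : R) :
    zElem i j hij ξ ζ ∈ Subgroup.closure (zSet n I) :=
  Subgroup.subset_closure ⟨i, j, hij, ξ, hξ, ζ, rfl⟩

theorem elemT_mem_closure_zSet {i j : Fin n} (hij : i ≠ j) {ξ : R} (hξ : ξ ∈ I) :
    elemT i j hij ξ ∈ Subgroup.closure (zSet n I) :=
  zElem.zero_right hij ξ ▸ zElem_mem_closure_zSet hij hξ 0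

theorem elemT_conj_zElem_mem (hn : 3 ≤ n) {i j k l : Fin n} (hij : i ≠ j) (hkl : k ≠ l)
    {ξ : R} (hξ : ξ ∈ I) (ζ η : R) :
    elemT k l hkl η * zElem i j hij ξ ζ * elemT k l hkl (-η) ∈
      Subgroup.closure (zSet n I) := by
  have hz := zElem_mem_closure_zSet hij hξ ζ
  have hI (x : R) : ξ * x ∈ I := I.mul_mem_right x hξ
  have snd_third {i j h : Fin n} (hij : i ≠ j) (hhi : h ≠ i) (hhj : h ≠ j) {ξ : R} (hξ : ξ ∈ I)
      (ζ η : R) : elemT j h hhj.symm η * zElem i j hij ξ ζ * elemT j h hhj.symm (-η) ∈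
        Subgroup.closure (zSet n I) := by
    rw [zElem.conj_snd_third hij hhi hhj]
    exact mul_mem (mul_mem (elemT_mem_closure_zSet _ (neg_mem (I.mul_mem_right _ hξ)))
      (elemT_mem_closure_zSet _ (neg_mem (I.mul_mem_right _ (I.mul_mem_right _ hξ)))))
      (zElem_mem_closure_zSet hij hξ ζ)
  by_cases hki : k = i
  · subst hki
    by_cases hlj : l = j
    · subst hlj
      obtain ⟨h, hh⟩ : ∃ h, h ∉ ({k, l} : Finset (Fin n)) := by
        by_contra! hall
        have := (Finset.card_le_card fun x _ => hall x : (Finset.univ : Finset (Fin n)).card ≤ _)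
        have := Finset.card_le_two (a := k) (b := l)
        simp at *
        omega
      simp only [Finset.mem_insert, Finset.mem_singleton, not_or] at hh
      rw [zElem.conj_fst_snd hij hh.1 hh.2]
      refine mul_mem (mul_mem (mul_mem ?_ ?_) ?_) ?_
      · exact elemT_mem_closure_zSet _ (hI _)
      · exact elemT_mem_closure_zSet _ (hI _)
      · exact snd_third (Ne.symm hh.1) hij.symm (Ne.symm hh.2) (neg_mem (hI _)) _ _
      · exact snd_third (Ne.symm hh.2) hij (Ne.symm hh.1) (neg_mem (hI _)) _ _
    · rw [zElem.conj_fst_third hij hkl.symm hlj, mul_assoc ξ, mul_assoc ξ]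
      exact mul_mem (mul_mem (elemT_mem_closure_zSet _ (hI _)) (elemT_mem_closure_zSet _ (hI _))) hz
  by_cases hkj : k = j
  · subst hkj
    by_cases hli : l = i
    · subst hli
      have : elemT k l hkl η * zElem l k hij ξ ζ * elemT k l hkl (-η) =
          zElem l k hij ξ (η + ζ) := by
        simp only [zElem, neg_add_rev, ← elemT.mul_eq_add, mul_assoc]
      exact this ▸ zElem_mem_closure_zSet hij hξ _
    · exact snd_third hij hli hkl.symm hξ ζ η
  by_cases hli : l = i
  · subst hli
    rw [zElem.conj_third_fst hij hkl hkj, mul_assoc ξ]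
    exact mul_mem (mul_mem (elemT_mem_closure_zSet _ (hI _))
      (elemT_mem_closure_zSet _ (neg_mem (hI _)))) hz
  by_cases hlj : l = j
  · subst hlj
    rw [zElem.conj_third_snd hij hki hkl, mul_assoc ξ, mul_assoc ξ]
    exact mul_mem (mul_mem (elemT_mem_closure_zSet _ (hI _))
      (elemT_mem_closure_zSet _ (neg_mem (hI _)))) hz
  have hc : Commute (elemT k l hkl η) (zElem i j hij ξ ζ) :=
    ((elemT.commute hkl hij.symm hlj (Ne.symm hki) η ζ).mul_right
      (elemT.commute hkl hij hli (Ne.symm hkj) η ξ)).mul_right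
      (elemT.commute hkl hij.symm hlj (Ne.symm hki) η (-ζ))
  rwa [hc.eq, mul_assoc, elemT.mul_neg_self, mul_one]

theorem elemSubgroup_le_normalizer_closure_zSet (hn : 3 ≤ n) :
    elemSubgroup n R ≤ Subgroup.normalizer (Subgroup.closure (zSet n I)) := by
  refine (Subgroup.closure_le _).2 ?_
  rintro _ ⟨k, l, hkl, η, rfl⟩
  have conj_mem (η : R) : ∀ x ∈ Subgroup.closure (zSet n I),
      elemT k l hkl η * x * (elemT k l hkl η)⁻¹ ∈ Subgroup.closure (zSet n I) := by
    suffices Subgroup.closure (zSet n I) ≤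
        (Subgroup.closure (zSet n I)).comap (MulAut.conj (elemT k l hkl η)).toMonoidHom from
      fun x hx => this hx
    refine (Subgroup.closure_le _).2 ?_
    rintro _ ⟨i, j, hij, ξ, hξ, ζ, rfl⟩
    simpa [elemT.inv_eq] using elemT_conj_zElem_mem hn hij hkl hξ ζ η
  refine Subgroup.mem_normalizer_iff.2 fun x => ⟨conj_mem η x, fun hx => ?_⟩
  have := conj_mem (-η) _ hx
  rw [← elemT.inv_eq] at this
  simpa [mul_assoc] using this

end Closure

/-- For n ≥ 3, the relative elementary subgroup E(n,R,I) is generated, as a group,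
by the elements z_ij(ξ,ζ), ξ ∈ I, ζ ∈ R. -/
theorem relElemSubgroup_eq_closure_zSet (n : ℕ) (hn : 3 ≤ n)
    (R : Type*) [CommRing R] (I : Ideal R) :
    relElemSubgroup n I = Subgroup.closure (zSet n I) := by
  apply le_antisymm
  · refine (Subgroup.closure_le _).2 ?_
    rintro _ ⟨g, hg, x, hx, rfl⟩
    have hle : elemSubgroupIdeal n I ≤ Subgroup.closure (zSet n I) := by
      refine (Subgroup.closure_le _).2 ?_
      rintro _ ⟨i, j, hij, ξ, hξ, rfl⟩
      exact elemT_mem_closure_zSet hij hξ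
    exact (Subgroup.mem_normalizer_iff.1
      (elemSubgroup_le_normalizer_closure_zSet hn hg) x).1 (hle hx)
  · refine (Subgroup.closure_le _).2 ?_
    rintro _ ⟨i, j, hij, ξ, hξ, ζ, rfl⟩
    refine Subgroup.subset_closure ⟨elemT j i hij.symm ζ,
      Subgroup.subset_closure ⟨j, i, hij.symm, ζ, rfl⟩, elemT i j hij ξ,
      Subgroup.subset_closure ⟨i, j, hij, ξ, hξ, rfl⟩, ?_⟩
    rw [zElem, elemT.inv_eq]
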